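/- Suppose ℝ² × ℝ carries a metric space structure whose distance is the Koranyi distance d_K(x,y) = (‖x₁−y₁‖⁴ + (x₂ − y₂ − 2ω(x₁,y₁))²)^{1/4}, where ‖·‖ is the Euclidean norm on ℝ² and ω((a,b),(c,d)) = ad − bc. Let α > 0 and let E ⊆ ℝ² × ℝ be a Borel set with 0 < H^α_{d_K}(E) < ∞ such that Θ^α_{d_K}(E,x) = 1 for H^α_{d_K}-almost every x ∈ E. Then α = 1 and E can be covered, up to an H^1_{d_K}-null set, by countably many Lipschitz images of compact subsets of ℝ. -/

import Mathlib

open MeasureTheory Filter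
open scoped ENNReal NNReal

/-- The first Heisenberg group `ℝ² × ℝ` as a bare type. -/
def Heis : Type := (ℝ × ℝ) × ℝ

/-- First-layer (horizontal) component. -/
noncomputable def Heis.h (p : Heis) : ℝ × ℝ := p.1

/-- Second-layer (vertical) component. -/
noncomputable def Heis.v (p : Heis) : ℝ := p.2

/-- The standard symplectic form `ω((a,b),(c,d)) = ad - bc` on `ℝ²`. -/
noncomputable def Heis.omega (a b : ℝ × ℝ) : ℝ := a.1 * b.2 - a.2 * b.1

/-- The Euclidean norm on `ℝ²`. -/
noncomputable def Heis.enorm2 (a : ℝ × ℝ) : ℝ := Real.sqrt (a.1 ^ 2 + a.2 ^ 2)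

/-- The Koranyi distance on the first Heisenberg group. -/
noncomputable def Heis.koranyi (p q : Heis) : ℝ :=
  (Heis.enorm2 (p.h - q.h) ^ 4 + (p.v - q.v - 2 * Heis.omega p.h q.h) ^ 2) ^ ((1 : ℝ) / 4)

/-- The distance function of a metric-space structure on `Heis`. -/
noncomputable def Heis.dist' (m : MetricSpace Heis) (p q : Heis) : ℝ :=
  letI := m; dist p q

/-- The Borel σ-algebra of a metric-space structure on `Heis`. -/
noncomputable def Heis.borelMS (m : MetricSpace Heis) : MeasurableSpace Heis :=
  letI := m; borel Heis

/-- The `α`-dimensional Hausdorff measure for a metric-space structure on `Heis`. -/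
noncomputable def Heis.hausdorff (m : MetricSpace Heis) (α : ℝ) :
    @Measure Heis (Heis.borelMS m) :=
  letI := m
  letI : MeasurableSpace Heis := Heis.borelMS m
  haveI : BorelSpace Heis := ⟨rfl⟩
  μH[α]

/-- Closed ball for a metric-space structure on `Heis`. -/
def Heis.cball (m : MetricSpace Heis) (x : Heis) (r : ℝ) : Set Heis :=
  letI := m; Metric.closedBall x r

/-- `f` is `K`-Lipschitz on `A ⊆ ℝ` as a map into `(Heis, m)`. -/
def Heis.lipOn (m : MetricSpace Heis) (K : ℝ≥0) (f : ℝ → Heis) (A : Set ℝ) : Prop :=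
  letI := m; LipschitzOnWith K f A

set_option linter.unusedSectionVars false

section MetricPart

open Metric Set Topology

variable {X : Type*} [MetricSpace X] [MeasurableSpace X] [BorelSpace X]

/-- A slightly enlarged closed set keeps a strict density inequality. -/
lemma hd_thicken (μ : Measure X) (α : ℝ) (hα : 0 < α) (k : ℝ≥0∞) (hk : k ≠ ⊤)
    (x : X) (S : Set X) (hx : x ∈ S) (ρ : ℝ) (hρ : 0 < ρ)
    (hS : ediam S ≤ ENNReal.ofReal (ρ / 2)) (hlt : k * ediam S ^ α < μ S) :
    ∃ B : Set X, IsClosed B ∧ x ∈ interior B ∧ ediam B ≤ ENNReal.ofReal ρ ∧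
      k * ediam B ^ α ≤ μ B := by
  have hSf : ediam S ≠ ⊤ := ne_top_of_le_ne_top ENNReal.ofReal_ne_top hS
  have hcont : Tendsto (fun η : ℝ≥0 => k * (ediam S + 2 * (η : ℝ≥0∞)) ^ α) (𝓝 0)
      (𝓝 (k * (ediam S + 2 * ((0 : ℝ≥0) : ℝ≥0∞)) ^ α)) := by
    have h1 : Tendsto (fun η : ℝ≥0 => ediam S + 2 * (η : ℝ≥0∞)) (𝓝 0)
        (𝓝 (ediam S + 2 * ((0 : ℝ≥0) : ℝ≥0∞))) := by
      refine Tendsto.const_add _ ?_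
      refine ENNReal.Tendsto.const_mul ?_ (Or.inr (by simp))
      exact ENNReal.tendsto_coe.2 tendsto_id
    have h2 := (ENNReal.continuous_rpow_const (y := α)).continuousAt.tendsto.comp h1
    exact ENNReal.Tendsto.const_mul h2 (Or.inr hk)
  have hev : ∀ᶠ η : ℝ≥0 in 𝓝 0, k * (ediam S + 2 * (η : ℝ≥0∞)) ^ α < μ S :=
    hcont.eventually_lt_const (by simpa using hlt)
  have hev2 : ∀ᶠ η : ℝ≥0 in 𝓝 0, η < Real.toNNReal (ρ / 4) :=
    eventually_lt_nhds (by simpa using hρ)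
  have hev3 : ∀ᶠ η : ℝ≥0 in 𝓝[>] 0, k * (ediam S + 2 * (η : ℝ≥0∞)) ^ α < μ S ∧
      η < Real.toNNReal (ρ / 4) :=
    (hev.and hev2).filter_mono nhdsWithin_le_nhds
  obtain ⟨η, ⟨h1, h2⟩, h3⟩ := (hev3.and self_mem_nhdsWithin).exists
  have h3' : (0 : ℝ) < η := by exact_mod_cast h3
  refine ⟨cthickening η S, isClosed_cthickening, ?_, ?_, ?_⟩
  · exact interior_mono (thickening_subset_cthickening η S)
      ((isOpen_thickening (δ := (η : ℝ)) (E := S)).interior_eq.symm ▸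
        self_subset_thickening h3' S hx)
  · refine (ediam_cthickening_le η).trans ?_
    have h4 : (η : ℝ≥0∞) ≤ ENNReal.ofReal (ρ / 4) := by
      exact ENNReal.coe_le_coe.2 h2.le
    calc ediam S + 2 * (η : ℝ≥0∞) ≤ ENNReal.ofReal (ρ / 2) + 2 * ENNReal.ofReal (ρ / 4) := by
          gcongr
      _ = ENNReal.ofReal ρ := by
          rw [show (2 : ℝ≥0∞) = ENNReal.ofReal 2 by simp, ← ENNReal.ofReal_mul (by norm_num),
            ← ENNReal.ofReal_add (by positivity) (by positivity)]
          congr 1; ring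
  · calc k * ediam (cthickening η S) ^ α ≤ k * (ediam S + 2 * (η : ℝ≥0∞)) ^ α := by
          gcongr; exact ediam_cthickening_le η
      _ ≤ μ S := h1.le
      _ ≤ μ (cthickening η S) := measure_mono (self_subset_cthickening S)

/-- The upper density estimate for the Hausdorff measure, along arbitrary small sets. -/
lemma hd_upper_null [SecondCountableTopology X] (α : ℝ) (hα : 0 < α) (E : Set X)
    (hE : MeasurableSet E) (hfin : μH[α] E < ⊤) (k : ℝ≥0∞) (hk1 : 1 < k) (hk : k ≠ ⊤)
    (P : Set X) (hPE : P ⊆ E)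
    (hball : ∀ x ∈ P, ∃ δ > (0 : ℝ), ∀ r, 0 < r → r ≤ δ →
      ((μH[α] : Measure X).restrict E) (closedBall x r) ≤ 2 * ENNReal.ofReal (2 * r) ^ α)
    (hbad : ∀ x ∈ P, ∀ δ > (0 : ℝ), ∃ S : Set X, x ∈ S ∧ ediam S ≤ ENNReal.ofReal δ ∧
      k * ediam S ^ α < ((μH[α] : Measure X).restrict E) S) :
    (μH[α] : Measure X) P = 0 := by
  set μ : Measure X := (μH[α] : Measure X).restrict E with hμ
  have : IsFiniteMeasure μ := ⟨by simpa [hμ] using hfin⟩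
  have hμP : ∀ T ⊆ E, μ T = μH[α] T := by
    intro T hT
    rw [hμ, Measure.restrict_apply' hE, inter_eq_left.2 hT]
  have hPfin : μ P ≠ ⊤ := measure_ne_top _ _
  -- main estimate
  have key : ∀ U : Set X, P ⊆ U → IsOpen U → k * μ P ≤ μ U := by
    intro U hPU hU
    have step : ∀ n : ℕ, ∃ u : Set (X × Set X), u.Countable ∧ u.PairwiseDisjoint Prod.snd ∧
        (∀ a ∈ u, IsClosed a.2 ∧ a.2 ⊆ U ∧ ediam a.2 ≤ ENNReal.ofReal (1 / ((n : ℝ) + 1)) ∧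
          k * ediam a.2 ^ α ≤ μ a.2) ∧ μ (P \ ⋃ a ∈ u, a.2) = 0 := by
      intro n
      set C : ℝ≥0 := 2 * 6 ^ α with hC
      let t : Set (X × Set X) := {a | IsClosed a.2 ∧ a.1 ∈ interior a.2 ∧ a.2 ⊆ U ∧
        ediam a.2 ≤ ENNReal.ofReal (1 / ((n : ℝ) + 1)) ∧ k * ediam a.2 ^ α ≤ μ a.2 ∧
        μ (closedBall a.1 (3 * diam a.2)) ≤ C * μ a.2}
      obtain ⟨u, hut, huc, hud, hu0⟩ := Vitali.exists_disjoint_covering_ae μ P t C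
        (fun a => diam a.2) Prod.fst Prod.snd
        (by
          rintro a ⟨-, hx, -, hd, -⟩ y hy
          rw [mem_closedBall]
          exact dist_le_diam_of_mem' (ne_top_of_le_ne_top ENNReal.ofReal_ne_top hd) hy
            (interior_subset hx))
        (by rintro a ⟨-, -, -, -, -, h⟩; exact h)
        (by rintro a ⟨-, hx, -⟩; exact ⟨_, hx⟩)
        (by rintro a ⟨h, -⟩; exact h)
        (by
          intro x hx ρ hρ
          obtain ⟨δ, hδ, hb⟩ := hball x hx
          obtain ⟨σ, hσ, hσU⟩ := Metric.isOpen_iff.1 hU x (hPU hx)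
          set ρ' : ℝ := min (min ρ (δ / 3)) (min (σ / 2) (1 / ((n : ℝ) + 1))) with hρ'
          have hρ'0 : 0 < ρ' := by positivity
          have h1 : ρ' ≤ ρ := (min_le_left _ _).trans (min_le_left _ _)
          have h2 : ρ' ≤ δ / 3 := (min_le_left _ _).trans (min_le_right _ _)
          have h3 : ρ' ≤ σ / 2 := (min_le_right _ _).trans (min_le_left _ _)
          have h4 : ρ' ≤ 1 / ((n : ℝ) + 1) := (min_le_right _ _).trans (min_le_right _ _)
          obtain ⟨S, hxS, hSd, hSl⟩ := hbad x hx (ρ' / 2) (by positivity)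
          obtain ⟨B, hBc, hxB, hBd, hBm⟩ := hd_thicken μ α hα k hk x S hxS ρ' hρ'0 hSd hSl
          have hBf : ediam B ≠ ⊤ := ne_top_of_le_ne_top ENNReal.ofReal_ne_top hBd
          have hxB' : x ∈ B := interior_subset hxB
          have hdB : diam B ≤ ρ' := ENNReal.toReal_le_of_le_ofReal hρ'0.le hBd
          have hBU : B ⊆ U := by
            intro y hy
            apply hσU
            rw [mem_ball]
            have := dist_le_diam_of_mem' hBf hy hxB'
            linarith
          refine ⟨(x, B), ⟨hBc, hxB, hBU, hBd.trans (ENNReal.ofReal_le_ofReal h4), hBm, ?_⟩,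
            hdB.trans h1, rfl⟩
          show μ (closedBall x (3 * diam B)) ≤ C * μ B
          have hC1 : (1 : ℝ≥0) ≤ C := by
            rw [hC]
            have : (1 : ℝ≥0) ≤ 6 ^ α := NNReal.one_le_rpow (by norm_num) hα.le
            calc (1 : ℝ≥0) = 1 * 1 := by ring
              _ ≤ 2 * 6 ^ α := by gcongr; norm_num
          rcases (diam_nonneg (s := B)).eq_or_lt with h0 | h0
          · rw [← h0, mul_zero, closedBall_zero]
            calc μ {x} ≤ μ B := measure_mono (by simpa using hxB')
              _ = 1 * μ B := by rw [one_mul]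
              _ ≤ C * μ B := by gcongr; exact_mod_cast hC1
          · have hb' := hb (3 * diam B) (by positivity) (by linarith)
            refine hb'.trans ?_
            have e1 : ENNReal.ofReal (2 * (3 * diam B)) = 6 * ediam B := by
              rw [show 2 * (3 * diam B) = 6 * diam B by ring, ENNReal.ofReal_mul (by norm_num)]
              congr 1
              · simp
              · exact ENNReal.ofReal_toReal hBf
            rw [e1, ENNReal.mul_rpow_of_nonneg _ _ hα.le, ← mul_assoc]
            have e2 : (C : ℝ≥0∞) = 2 * 6 ^ α := by
              rw [hC]; push_cast
              rw [ENNReal.coe_rpow_of_nonneg _ hα.le]; norm_num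
            rw [e2]
            gcongr
            calc ediam B ^ α = 1 * ediam B ^ α := by rw [one_mul]
              _ ≤ k * ediam B ^ α := by gcongr
              _ ≤ μ B := hBm)
      refine ⟨u, huc, hud, fun a ha => ?_, hu0⟩
      obtain ⟨h1, -, h3, h4, h5, -⟩ := hut ha
      exact ⟨h1, h3, h4, h5⟩
    choose u huc hud hu hu0 using step
    set P0 : Set X := P \ ⋃ n, (P \ ⋃ a ∈ u n, a.2) with hP0
    have hnull : μ (⋃ n, (P \ ⋃ a ∈ u n, a.2)) = 0 := measure_iUnion_null hu0
    have hPP0 : μ P ≤ μ P0 := by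
      calc μ P ≤ μ (P0 ∪ ⋃ n, (P \ ⋃ a ∈ u n, a.2)) := measure_mono (by
            rw [hP0]; intro x hx; by_cases h : x ∈ ⋃ n, (P \ ⋃ a ∈ u n, a.2)
            · exact Or.inr h
            · exact Or.inl ⟨hx, h⟩)
        _ ≤ μ P0 + 0 := by rw [← hnull]; exact measure_union_le _ _
        _ = μ P0 := add_zero _
    have : ∀ n, Countable (u n) := fun n => (huc n).to_subtype
    have hH : μH[α] P0 ≤ liminf (fun n : ℕ => ∑' i : u n, ediam (i.1.2) ^ α) atTop := by
      refine Measure.hausdorffMeasure_le_liminf_tsum α P0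
        (fun n : ℕ => ENNReal.ofReal (1 / ((n : ℝ) + 1))) ?_ (fun n (i : u n) => i.1.2) ?_ ?_
      · have := (ENNReal.continuous_ofReal.tendsto 0).comp
          (tendsto_one_div_add_atTop_nhds_zero_nat (𝕜 := ℝ))
        simpa [Function.comp_def] using this
      · exact Eventually.of_forall fun n i => (hu n i.1 i.2).2.2.1
      · refine Eventually.of_forall fun n x hx => ?_
        have h1 : x ∈ P := hx.1
        have h2 : x ∉ ⋃ n, (P \ ⋃ a ∈ u n, a.2) := hx.2
        by_contra hcon
        apply h2
        refine mem_iUnion.2 ⟨n, h1, ?_⟩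
        intro hmem
        obtain ⟨a, ha, hxa⟩ := mem_iUnion₂.1 hmem
        exact hcon (mem_iUnion.2 ⟨⟨a, ha⟩, hxa⟩)
    have hsum : ∀ n : ℕ, k * ∑' i : u n, ediam (i.1.2) ^ α ≤ μ U := by
      intro n
      rw [← ENNReal.tsum_mul_left]
      calc ∑' i : u n, k * ediam (i.1.2) ^ α ≤ ∑' i : u n, μ i.1.2 :=
            ENNReal.tsum_le_tsum fun i => (hu n i.1 i.2).2.2.2
        _ = μ (⋃ i : u n, i.1.2) := by
            rw [measure_iUnion]
            · intro i j hij
              exact hud n i.2 j.2 (fun h => hij (Subtype.ext h))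
            · intro i; exact (hu n i.1 i.2).1.measurableSet
        _ ≤ μ U := measure_mono (iUnion_subset fun i => (hu n i.1 i.2).2.1)
    have hk0 : k ≠ 0 := (lt_trans zero_lt_one hk1).ne'
    have hlim : liminf (fun n : ℕ => ∑' i : u n, ediam (i.1.2) ^ α) atTop ≤ μ U / k := by
      refine liminf_le_of_le (by isBoundedDefault) ?_
      intro b hb
      obtain ⟨n, hn⟩ := hb.exists
      refine hn.trans ?_
      rw [ENNReal.le_div_iff_mul_le (Or.inl hk0) (Or.inl hk), mul_comm]
      exact hsum n
    have hfinal : μ P ≤ μ U / k := by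
      refine hPP0.trans ?_
      rw [hμP P0 (sdiff_subset.trans hPE)]
      exact hH.trans hlim
    rw [ENNReal.le_div_iff_mul_le (Or.inl hk0) (Or.inl hk)] at hfinal
    rwa [mul_comm]
  have hle : k * μ P ≤ μ P := by
    refine ENNReal.le_of_forall_pos_le_add fun ε hε _ => ?_
    obtain ⟨U, hPU, hU, hlt⟩ := P.exists_isOpen_lt_add hPfin (ε := (ε : ℝ≥0∞))
      (by exact_mod_cast hε.ne')
    exact (key U hPU hU).trans hlt.le
  rw [← hμP P hPE]
  by_contra h0
  have : 1 * μ P < k * μ P := (ENNReal.mul_lt_mul_iff_left h0 hPfin).2 hk1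
  rw [one_mul] at this
  exact absurd hle (not_le.2 this)


/-- Uniformly good points at scale `δ`. -/
def HGood (μ : Measure X) (α ε δ : ℝ) (x : X) : Prop :=
  (∀ r, 0 < r → r ≤ δ → (1 - ε) * (2 * r) ^ α ≤ μ.real (closedBall x r)) ∧
  (∀ (S : Set X) (D : ℝ), x ∈ S → D ≤ δ → (∀ a ∈ S, ∀ b ∈ S, dist a b ≤ D) →
    μ.real S ≤ (1 + ε) * D ^ α)

lemma hgood_ae [SecondCountableTopology X] (α : ℝ) (hα : 0 < α) (E : Set X)
    (hE : MeasurableSet E) (hfin : μH[α] E < ⊤)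
    (hdens : ∀ᵐ x ∂((μH[α] : Measure X).restrict E),
      Tendsto (fun r : ℝ => (μH[α] : Measure X) (E ∩ closedBall x r) / ENNReal.ofReal (2 * r) ^ α)
        (𝓝[>] 0) (𝓝 1)) (ε : ℝ) (hε : 0 < ε) (hε1 : ε < 1) :
    ∀ᵐ x ∂((μH[α] : Measure X).restrict E),
      ∃ n : ℕ, HGood ((μH[α] : Measure X).restrict E) α ε (1 / ((n : ℝ) + 1)) x := by
  set μ : Measure X := (μH[α] : Measure X).restrict E with hμ
  have : IsFiniteMeasure μ := ⟨by simpa [hμ] using hfin⟩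
  set k : ℝ≥0∞ := ENNReal.ofReal (1 + ε) with hk
  have hk1 : 1 < k := by
    rw [hk, ← ENNReal.ofReal_one]
    exact (ENNReal.ofReal_lt_ofReal_iff (by linarith)).2 (by linarith)
  have hμb : ∀ x r, μH[α] (E ∩ closedBall x r) = μ (closedBall x r) := by
    intro x r
    rw [hμ, Measure.restrict_apply' hE, inter_comm]
  simp only [hμb] at hdens
  have hpow : ∀ r : ℝ, 0 < r → ENNReal.ofReal (2 * r) ^ α ≠ 0 ∧
      ENNReal.ofReal (2 * r) ^ α ≠ ⊤ := by
    intro r hr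
    have h0 : ENNReal.ofReal (2 * r) ≠ 0 := by
      simp only [ne_eq, ENNReal.ofReal_eq_zero, not_le]; linarith
    exact ⟨(ENNReal.rpow_pos (pos_iff_ne_zero.2 h0) ENNReal.ofReal_ne_top).ne',
      ENNReal.rpow_ne_top_of_nonneg hα.le ENNReal.ofReal_ne_top⟩
  set P : Set X := {x | x ∈ E ∧ Tendsto (fun r : ℝ => μ (closedBall x r) /
      ENNReal.ofReal (2 * r) ^ α) (𝓝[>] 0) (𝓝 1) ∧
      ∀ δ > (0 : ℝ), ∃ S : Set X, x ∈ S ∧ ediam S ≤ ENNReal.ofReal δ ∧ k * ediam S ^ α < μ S} with hP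
  have hP0 : μH[α] P = 0 := by
    refine hd_upper_null α hα E hE hfin k hk1 ENNReal.ofReal_ne_top P (fun x hx => hx.1) ?_
      (fun x hx => hx.2.2)
    intro x hx
    have h1 := hx.2.1.eventually_lt_const (u := 2) (by norm_num)
    obtain ⟨δ, hδ, hd⟩ := mem_nhdsGT_iff_exists_Ioc_subset.1 h1
    refine ⟨δ, hδ, fun r hr hrd => ?_⟩
    have h2 : μ (closedBall x r) / ENNReal.ofReal (2 * r) ^ α < 2 := hd ⟨hr, hrd⟩
    exact ((ENNReal.div_le_iff (hpow r hr).1 (hpow r hr).2).1 h2.le)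
  have hPae : ∀ᵐ x ∂μ, x ∉ P := by
    rw [ae_iff]; simp only [not_not]
    exact le_antisymm ((Measure.restrict_apply_le _ _).trans hP0.le) bot_le
  filter_upwards [hdens, ae_restrict_mem hE, hPae] with x hx hxE hxP
  have hx1 : ∃ δ > (0 : ℝ), ∀ S : Set X, x ∈ S → ediam S ≤ ENNReal.ofReal δ →
      μ S ≤ k * ediam S ^ α := by
    by_contra hcon
    push Not at hcon
    exact hxP ⟨hxE, hx, hcon⟩
  obtain ⟨δ1, hδ1, hS⟩ := hx1
  have h1 := hx.eventually_const_lt (u := ENNReal.ofReal (1 - ε)) (by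
    rw [← ENNReal.ofReal_one]
    exact (ENNReal.ofReal_lt_ofReal_iff (by linarith)).2 (by linarith))
  obtain ⟨δ2, hδ2, hd⟩ := mem_nhdsGT_iff_exists_Ioc_subset.1 h1
  obtain ⟨n, hn⟩ := exists_nat_one_div_lt (lt_min hδ1 hδ2)
  have hn1 := hn.le.trans (min_le_left _ _)
  have hn2 := hn.le.trans (min_le_right _ _)
  refine ⟨n, fun r hr hrn => ?_, fun S D hxS hD hSD => ?_⟩
  · have h2 : ENNReal.ofReal (1 - ε) < μ (closedBall x r) / ENNReal.ofReal (2 * r) ^ α :=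
      hd ⟨hr, hrn.trans hn2⟩
    have h3 := (ENNReal.le_div_iff_mul_le (Or.inl (hpow r hr).1) (Or.inl (hpow r hr).2)).1 h2.le
    have h4 := ENNReal.toReal_mono (measure_ne_top μ _) h3
    rw [ENNReal.toReal_mul, ← ENNReal.toReal_rpow, ENNReal.toReal_ofReal (by linarith),
      ENNReal.toReal_ofReal (by linarith)] at h4
    exact h4
  · have hD0 : 0 ≤ D := by simpa using hSD x hxS x hxS
    have h2 : ediam S ≤ ENNReal.ofReal D := ediam_le fun a ha b hb => by
      rw [edist_dist]; exact ENNReal.ofReal_le_ofReal (hSD a ha b hb)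
    have h3 : μ S ≤ k * ENNReal.ofReal D ^ α :=
      (hS S hxS (h2.trans (ENNReal.ofReal_le_ofReal (hD.trans hn1)))).trans (by gcongr)
    have h4 := ENNReal.toReal_mono (ENNReal.mul_ne_top ENNReal.ofReal_ne_top
      (ENNReal.rpow_ne_top_of_nonneg hα.le ENNReal.ofReal_ne_top)) h3
    rw [ENNReal.toReal_mul, ← ENNReal.toReal_rpow, ENNReal.toReal_ofReal (by linarith),
      ENNReal.toReal_ofReal hD0] at h4
    exact h4

/-- Two good points give a lower bound on the dimension. -/
lemma hgood_two (μ : Measure X) [IsFiniteMeasure μ] (α ε δ : ℝ) (hα : 0 < α) (hε : 0 < ε)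
    (hε1 : ε < 1) (x y : X) (hx : HGood μ α ε δ x) (hy : HGood μ α ε δ y) (hxy : x ≠ y)
    (hd : dist x y ≤ δ / 4) :
    2 * (1 - ε) * (1 - ε) ^ α ≤ (1 + ε) * 2 ^ α := by
  set r := dist x y with hr
  have hr0 : 0 < r := dist_pos.2 hxy
  set ρ := (1 - ε) * r / 2 with hρ
  have hρ0 : 0 < ρ := by have : 0 < 1 - ε := by linarith
                         positivity
  have hρr : 2 * ρ < r := by rw [hρ]; nlinarith
  have hdis : Disjoint (closedBall x ρ) (closedBall y ρ) :=
    closedBall_disjoint_closedBall (by linarith)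
  have h1 := hx.1 ρ hρ0 (by linarith)
  have h2 := hy.1 ρ hρ0 (by linarith)
  have h3 := hx.2 (closedBall x ρ ∪ closedBall y ρ) (2 * r)
    (Or.inl (mem_closedBall_self hρ0.le)) (by linarith) (by
      have tri := fun a b c : X => dist_triangle a b c
      rintro a (ha | ha) b (hb | hb) <;> rw [mem_closedBall] at ha hb
      · linarith [dist_triangle_right a b x]
      · linarith [dist_triangle4_right a b x y]
      · linarith [dist_triangle4_right a b y x, dist_comm x y]
      · linarith [dist_triangle_right a b y])
  rw [measureReal_union hdis measurableSet_closedBall] at h3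
  have e1 : (2 * ρ) ^ α = (1 - ε) ^ α * r ^ α := by
    rw [show 2 * ρ = (1 - ε) * r by rw [hρ]; ring, Real.mul_rpow (by linarith) hr0.le]
  have e2 : (2 * r) ^ α = 2 ^ α * r ^ α := Real.mul_rpow (by norm_num) hr0.le
  rw [e1] at h1 h2
  rw [e2] at h3
  have hrα : 0 < r ^ α := Real.rpow_pos_of_pos hr0 α
  have : (2 * (1 - ε) * (1 - ε) ^ α) * r ^ α ≤ ((1 + ε) * 2 ^ α) * r ^ α := by linarith
  exact le_of_mul_le_mul_right this hrα

/-- Two good points: the second one has an almost antipodal point with respect to the first. -/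
lemma hgood_antipode (μ : Measure X) [IsFiniteMeasure μ] (α ε δ η : ℝ) (hε1 : ε < 1)
    (hη : 0 < η) (hη1 : η < 1 / 2)
    (hc : (1 + ε) * (2 * (1 - η)) ^ α < (1 - ε) * ((2 * (1 - η)) ^ α + η ^ α))
    (x p : X) (hx : HGood μ α ε δ x) (hp : HGood μ α ε δ p)
    (hd : dist x p ≤ δ / 4) :
    ∃ q, dist x q ≤ dist x p ∧ (2 - 3 * η) * dist x p ≤ dist p q := by
  by_cases hxp : x = p
  · exact ⟨x, by simp [hxp], by simp [hxp]⟩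
  set r := dist x p with hr
  have hr0 : 0 < r := dist_pos.2 hxp
  set R := (1 - η) * r with hR
  set ρ := η * r / 2 with hρ
  have hρ0 : 0 < ρ := by positivity
  have hR0 : 0 < R := by have : 0 < 1 - η := by linarith
                         positivity
  have hRr : R + η * r = r := by rw [hR]; ring
  have hηr : η * r = 2 * ρ := by rw [hρ]; ring
  have hρR : 2 * ρ ≤ R := by rw [← hηr, hR]; nlinarith
  by_contra hcon
  push Not at hcon
  have hdis : Disjoint (closedBall x R) (closedBall p ρ) :=
    closedBall_disjoint_closedBall (by linarith)
  have h1 := hx.1 R hR0 (by linarith)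
  have h2 := hp.1 ρ hρ0 (by linarith)
  have h3 := hx.2 (closedBall x R ∪ closedBall p ρ) (2 * R)
    (Or.inl (mem_closedBall_self hR0.le)) (by linarith) (by
      have hcross : ∀ a b, dist a x ≤ R → dist b p ≤ ρ → dist a b ≤ 2 * R := by
        intro a b ha hb
        have h4 := hcon a (by rw [dist_comm]; linarith)
        have h5 : dist a b ≤ dist p a + dist b p := by
          rw [dist_comm p a, dist_comm b p]; exact dist_triangle _ _ _
        nlinarith
      rintro a (ha | ha) b (hb | hb) <;> rw [mem_closedBall] at ha hb
      · linarith [dist_triangle_right a b x]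
      · exact hcross a b ha hb
      · rw [dist_comm]; exact hcross b a hb ha
      · linarith [dist_triangle_right a b p])
  rw [measureReal_union hdis measurableSet_closedBall] at h3
  have e1 : (2 * R) ^ α = (2 * (1 - η)) ^ α * r ^ α := by
    rw [show 2 * R = (2 * (1 - η)) * r by rw [hR]; ring, Real.mul_rpow (by linarith) hr0.le]
  have e2 : (2 * ρ) ^ α = η ^ α * r ^ α := by
    rw [← hηr, Real.mul_rpow hη.le hr0.le]
  rw [e1] at h1 h3
  rw [e2] at h2
  have hrα : 0 < r ^ α := Real.rpow_pos_of_pos hr0 α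
  have := mul_lt_mul_of_pos_right hc hrα
  linarith

/-- Two Prim edges have disjoint lenses. -/
lemma prim_disjoint (y z y' z' w : X)
    (e1 : dist y z ≤ dist y' y ∨ dist y z ≤ dist y' z)
    (e2 : dist y' z' ≤ dist y y' ∨ dist y' z' ≤ dist y z')
    (f1 : dist y' z' ≤ dist z' y) (f2 : dist y' z' ≤ dist z' z) (hpos : 0 < dist y z)
    (q1 : dist z' y ≤ dist y z → dist z' z ≤ dist y z →
      dist z' y + dist z' z ≤ 1.01 * dist y z)
    (q2 : dist z' y ≤ dist z' z → dist y z ≤ dist z' z →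
      dist z' y + dist y z ≤ 1.01 * dist z' z)
    (q3 : dist z' z ≤ dist z' y → dist y z ≤ dist z' y →
      dist z' z + dist y z ≤ 1.01 * dist z' y)
    (w1 : dist w y ≤ 0.6 * dist y z) (w2 : dist w z ≤ 0.6 * dist y z)
    (w3 : dist w y' ≤ 0.6 * dist y' z') (w4 : dist w z' ≤ 0.6 * dist y' z') : False := by
  have t1 := dist_triangle_left y' y w
  have t2 := dist_triangle_left y' z w
  have t3 := dist_triangle_left y y' w
  have t4 := dist_triangle_left y z' w
  have t5 := dist_triangle_left z' y w
  have t6 := dist_triangle_left z' z w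
  have c1 : 0.6 * dist y z ≤ dist y' z' := by
    rcases e1 with h | h <;> linarith
  have c2 : 0.6 * dist y' z' ≤ dist y z := by
    rcases e2 with h | h <;> linarith
  by_cases hA : dist z' y ≤ dist z' z
  · by_cases hB : dist y z ≤ dist z' z
    · have := q2 hA hB; linarith
    · have := q1 (by linarith) (by linarith); linarith
  · by_cases hB : dist y z ≤ dist z' y
    · have := q3 (by linarith) hB; linarith
    · have := q1 (by linarith) (by linarith); linarith

/-- The lens of an edge. -/
def hLens (e : X × X) : Set X :=
  closedBall e.1 (0.6 * dist e.1 e.2) ∩ closedBall e.2 (0.6 * dist e.1 e.2)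

/-- Insertion of a point into an expanding time function. -/
lemma prim_insert (T : Finset X) (τ : X → ℝ) (L : ℝ) (y z : X) (hy : y ∈ T) (hz : z ∉ T)
    (h1 : ∀ x ∈ T, 0 ≤ τ x ∧ τ x ≤ L)
    (h2 : ∀ x ∈ T, ∀ x' ∈ T, dist x x' ≤ |τ x - τ x'|) :
    ∃ σ : X → ℝ, (∀ x, x = z ∨ x ∈ T → 0 ≤ σ x ∧ σ x ≤ L + 2 * dist y z) ∧
      ∀ x, x = z ∨ x ∈ T → ∀ x', x' = z ∨ x' ∈ T → dist x x' ≤ |σ x - σ x'| := by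
  classical
  set ℓ := dist y z with hℓ
  have hℓ0 : 0 ≤ ℓ := dist_nonneg
  let σ : X → ℝ := fun x => if x = z then τ y + ℓ else if τ x ≤ τ y then τ x else τ x + 2 * ℓ
  have hσz : σ z = τ y + ℓ := by simp [σ]
  have hσ1 : ∀ x ∈ T, τ x ≤ τ y → σ x = τ x := by
    intro x hx h
    have : x ≠ z := fun h => hz (h ▸ hx)
    simp [σ, this, h]
  have hσ2 : ∀ x ∈ T, τ y < τ x → σ x = τ x + 2 * ℓ := by
    intro x hx h
    have : x ≠ z := fun h => hz (h ▸ hx)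
    simp [σ, this, not_le.2 h]
  have hzT : ∀ x ∈ T, dist z x ≤ |σ z - σ x| := by
    intro x hx
    have h3 := h2 y hy x hx
    have h4 : dist z x ≤ ℓ + dist y x := by
      rw [hℓ, dist_comm y z]; exact dist_triangle _ _ _
    rcases le_or_gt (τ x) (τ y) with h | h
    · rw [hσz, hσ1 x hx h]
      rw [abs_of_nonneg (by linarith)] at h3
      rw [abs_of_nonneg (by linarith)]; linarith
    · rw [hσz, hσ2 x hx h]
      rw [abs_of_neg (by linarith)] at h3
      rw [abs_of_nonpos (by linarith)]; linarith
  refine ⟨σ, ?_, ?_⟩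
  · rintro x (rfl | hx)
    · rw [hσz]; have := h1 y hy; constructor <;> linarith
    · have := h1 x hx
      rcases le_or_gt (τ x) (τ y) with h | h
      · rw [hσ1 x hx h]; constructor <;> linarith
      · rw [hσ2 x hx h]; constructor <;> linarith
  · rintro x (rfl | hx) x' (rfl | hx')
    · simp
    · exact hzT x' hx'
    · rw [dist_comm, abs_sub_comm]; exact hzT x hx
    · have h3 := h2 x hx x' hx'
      rcases le_or_gt (τ x) (τ y) with h | h <;> rcases le_or_gt (τ x') (τ y) with h' | h'
      · rw [hσ1 x hx h, hσ1 x' hx' h']; exact h3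
      · rw [hσ1 x hx h, hσ2 x' hx' h']
        rw [abs_of_nonpos (by linarith)] at h3 ⊢; linarith
      · rw [hσ2 x hx h, hσ1 x' hx' h']
        rw [abs_of_nonneg (by linarith)] at h3 ⊢; linarith
      · rw [hσ2 x hx h, hσ2 x' hx' h']
        rwa [show τ x + 2 * ℓ - (τ x' + 2 * ℓ) = τ x - τ x' by ring]

lemma prim_tour (μ : Measure X) [IsFiniteMeasure μ] (F : Finset X)
    (hQC : ∀ x ∈ F, ∀ y ∈ F, ∀ z ∈ F, dist x y ≤ dist x z → dist y z ≤ dist x z →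
      dist x y + dist y z ≤ 1.01 * dist x z)
    (hlens : ∀ y ∈ F, ∀ z ∈ F, dist y z ≤ 10 * μ.real (hLens (y, z))) :
    ∃ τ : X → ℝ, (∀ x ∈ F, 0 ≤ τ x ∧ τ x ≤ 20 * μ.real univ) ∧
      ∀ x ∈ F, ∀ x' ∈ F, dist x x' ≤ |τ x - τ x'| := by
  classical
  rcases F.eq_empty_or_nonempty with rfl | hne
  · exact ⟨fun _ => 0, by simp, by simp⟩
  have main : ∀ n : ℕ, n + 1 ≤ F.card → ∃ T : Finset X, T ⊆ F ∧ T.card = n + 1 ∧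
      ∃ (edges : Finset (X × X)) (τ : X → ℝ) (L : ℝ),
        (∀ e ∈ edges, e.1 ∈ T ∧ e.2 ∈ T ∧ 0 < dist e.1 e.2 ∧
          ∀ u ∈ F, dist e.1 e.2 ≤ dist u e.1 ∨ dist e.1 e.2 ≤ dist u e.2) ∧
        L ≤ 20 * μ.real (⋃ e ∈ edges, hLens e) ∧
        (∀ x ∈ T, 0 ≤ τ x ∧ τ x ≤ L) ∧
        ∀ x ∈ T, ∀ x' ∈ T, dist x x' ≤ |τ x - τ x'| := by
    intro n
    induction n with
    | zero =>
      intro _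
      obtain ⟨a, ha⟩ := hne
      exact ⟨{a}, by simpa using ha, by simp, ∅, fun _ => 0, 0, by simp, by simp, by simp, by simp⟩
    | succ n ih =>
      intro hn
      obtain ⟨T, hTF, hTc, edges, τ, L, he, hL, hτ, hexp⟩ := ih (by omega)
      have hTne : T.Nonempty := Finset.card_pos.1 (by omega)
      have hCne : (F \ T).Nonempty := by
        apply Finset.card_pos.1
        rw [Finset.card_sdiff_of_subset hTF]; omega
      obtain ⟨⟨y, z⟩, hyz, hmin⟩ := Finset.exists_min_image (T ×ˢ (F \ T))
        (fun e => dist e.1 e.2) (hTne.product hCne)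
      simp only [Finset.mem_product, Finset.mem_sdiff, Prod.forall, and_imp] at hyz hmin
      obtain ⟨hyT, hzF, hzT⟩ := hyz
      have hyF := hTF hyT
      have hne' : y ≠ z := fun h => hzT (h ▸ hyT)
      have hempty : ∀ u ∈ F, dist y z ≤ dist u y ∨ dist y z ≤ dist u z := by
        intro u hu
        by_cases huT : u ∈ T
        · exact Or.inr (hmin u z huT hzF hzT)
        · left; rw [dist_comm u y]; exact hmin y u hyT hu huT
      have hdisj : ∀ e ∈ edges, Disjoint (hLens e) (hLens (y, z)) := by
        rintro ⟨a, b⟩ hab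
        obtain ⟨haT, hbT, hpos, hab0⟩ := he _ hab
        simp only at haT hbT hpos hab0
        have haF := hTF haT
        have hbF := hTF hbT
        rw [Set.disjoint_left]
        rintro w ⟨w1, w2⟩ ⟨w3, w4⟩
        simp only [mem_closedBall] at w1 w2 w3 w4
        refine prim_disjoint a b y z w (hab0 y hyF) ?_ ?_ ?_ hpos ?_ ?_ ?_ w1 w2 w3 w4
        · exact hempty a haF
        · rw [dist_comm z a]; exact hmin a z haT hzF hzT
        · rw [dist_comm z b]; exact hmin b z hbT hzF hzT
        · intro k1 k2
          have := hQC a haF z hzF b hbF (by rwa [dist_comm a z]) k2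
          rwa [dist_comm a z] at this
        · intro k1 k2
          exact hQC z hzF a haF b hbF k1 k2
        · intro k1 k2
          have := hQC z hzF b hbF a haF k1 (by rwa [dist_comm b a])
          rwa [dist_comm b a] at this
      obtain ⟨σ, hσ1, hσ2⟩ := prim_insert T τ L y z hyT hzT hτ hexp
      refine ⟨insert z T, Finset.insert_subset hzF hTF, by rw [Finset.card_insert_of_notMem hzT, hTc],
        insert (y, z) edges, σ, L + 2 * dist y z, ?_, ?_, ?_, ?_⟩
      · intro e hmem
        rcases Finset.mem_insert.1 hmem with rfl | h
        · exact ⟨Finset.mem_insert_of_mem hyT, Finset.mem_insert_self _ _, dist_pos.2 hne', hempty⟩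
        · obtain ⟨k1, k2, k3, k4⟩ := he e h
          exact ⟨Finset.mem_insert_of_mem k1, Finset.mem_insert_of_mem k2, k3, k4⟩
      · rw [Finset.set_biUnion_insert, measureReal_union ?_ ?_ (measure_ne_top _ _) (measure_ne_top _ _)]
        · have := hlens y hyF z hzF
          linarith
        · rw [Set.disjoint_iUnion₂_right]
          intro e h
          exact (hdisj e h).symm
        · refine Finset.measurableSet_biUnion _ fun e _ => ?_
          exact measurableSet_closedBall.inter measurableSet_closedBall
      · intro x hx; exact hσ1 x (Finset.mem_insert.1 hx)
      · intro x hx x' hx'; exact hσ2 x (Finset.mem_insert.1 hx) x' (Finset.mem_insert.1 hx')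
  have hcard := Finset.card_pos.2 hne
  obtain ⟨T, hTF, hTc, edges, τ, L, -, hL, hτ, hexp⟩ := main (F.card - 1) (by omega)
  have hT : T = F := Finset.eq_of_subset_of_card_le hTF (by omega)
  subst hT
  refine ⟨τ, fun x hx => ⟨(hτ x hx).1, (hτ x hx).2.trans (hL.trans ?_)⟩, hexp⟩
  have := measureReal_mono (μ := μ) (subset_univ (⋃ e ∈ edges, hLens e))
  linarith

/-- Compactness: an expanding bounded time function on every finite subset gives a global one. -/
lemma expand_compact (G : Set X) (C : ℝ)
    (h : ∀ F : Finset X, ↑F ⊆ G → ∃ τ : X → ℝ, (∀ x ∈ F, 0 ≤ τ x ∧ τ x ≤ C) ∧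
      ∀ x ∈ F, ∀ x' ∈ F, dist x x' ≤ |τ x - τ x'|) :
    ∃ τ : X → ℝ, (∀ x ∈ G, τ x ∈ Icc 0 C) ∧ ∀ x ∈ G, ∀ x' ∈ G, dist x x' ≤ |τ x - τ x'| := by
  classical
  have h' : ∀ F : Finset G, ∃ τ : X → ℝ, (∀ x ∈ F, 0 ≤ τ x ∧ τ x ≤ C) ∧
      ∀ x ∈ F, ∀ x' ∈ F, dist (x : X) x' ≤ |τ x - τ x'| := by
    intro F
    obtain ⟨τ, h1, h2⟩ := h (F.map (Function.Embedding.subtype _)) (by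
      intro x hx; simp only [Finset.coe_map, mem_image] at hx
      obtain ⟨a, -, rfl⟩ := hx; exact a.2)
    refine ⟨τ, fun x hx => h1 x (Finset.mem_map_of_mem _ hx), fun x hx x' hx' =>
      h2 x (Finset.mem_map_of_mem _ hx) x' (Finset.mem_map_of_mem _ hx')⟩
  choose τ h1 h2 using h'
  let U : Ultrafilter (Finset G) := Ultrafilter.of atTop
  have hU : (U : Filter (Finset G)) ≤ atTop := Ultrafilter.of_le _
  have hev : ∀ x : G, ∀ᶠ F : Finset G in (U : Filter (Finset G)), x ∈ F := by
    intro x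
    apply hU
    filter_upwards [eventually_ge_atTop {x}] with F hF
    exact hF (Finset.mem_singleton_self x)
  have hlim : ∀ x : G, ∃ t ∈ Icc 0 C, Tendsto (fun F => τ F x) U (𝓝 t) := by
    intro x
    obtain ⟨t, ht, hle⟩ := isCompact_Icc.ultrafilter_le_nhds (s := Icc 0 C)
      (U.map (fun F => τ F x)) (by
        rw [le_principal_iff]
        show ∀ᶠ F in (U : Filter (Finset G)), τ F x ∈ Icc 0 C
        filter_upwards [hev x] with F hF using h1 F x hF)
    exact ⟨t, ht, hle⟩
  choose t ht hlt using hlim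
  refine ⟨fun x => if hx : x ∈ G then t ⟨x, hx⟩ else 0, ?_, ?_⟩
  · intro x hx; simp only [hx, dif_pos]; exact ht _
  · intro x hx x' hx'
    simp only [hx, hx', dif_pos]
    refine ge_of_tendsto ((hlt ⟨x, hx⟩).sub (hlt ⟨x', hx'⟩)).abs ?_
    filter_upwards [hev ⟨x, hx⟩, hev ⟨x', hx'⟩] with F hF hG
    exact h2 F _ hF _ hG

/-- A bounded set with a bounded expanding time function lies in a Lipschitz image of a compact
subset of the line. -/
lemma expand_image [ProperSpace X] (G : Set X) (hG : Bornology.IsBounded G) (C : ℝ) (τ : X → ℝ)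
    (h1 : ∀ x ∈ G, τ x ∈ Icc 0 C) (h2 : ∀ x ∈ G, ∀ x' ∈ G, dist x x' ≤ |τ x - τ x'|)
    (x₀ : X) :
    ∃ (f : ℝ → X) (A : Set ℝ), IsCompact A ∧ LipschitzOnWith 1 f A ∧ G ⊆ f '' A := by
  classical
  set R : Set (ℝ × X) := closure ((fun x => (τ x, x)) '' G) with hR
  have hsub : R ⊆ Icc 0 C ×ˢ closure G := by
    refine closure_minimal ?_ (isClosed_Icc.prod isClosed_closure)
    rintro _ ⟨x, hx, rfl⟩
    exact ⟨h1 x hx, subset_closure hx⟩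
  have hRc : IsCompact R :=
    (isCompact_Icc.prod hG.isCompact_closure).of_isClosed_subset isClosed_closure hsub
  have hexp : ∀ a ∈ R, ∀ b ∈ R, dist a.2 b.2 ≤ dist a.1 b.1 := by
    have hcl : IsClosed {q : (ℝ × X) × (ℝ × X) | dist q.1.2 q.2.2 ≤ dist q.1.1 q.2.1} :=
      isClosed_le (by fun_prop) (by fun_prop)
    have : R ×ˢ R ⊆ {q : (ℝ × X) × (ℝ × X) | dist q.1.2 q.2.2 ≤ dist q.1.1 q.2.1} := by
      rw [hR, ← closure_prod_eq]
      refine closure_minimal ?_ hcl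
      rintro ⟨_, _⟩ ⟨⟨x, hx, rfl⟩, ⟨x', hx', rfl⟩⟩
      simp only [mem_ofPred_eq, Real.dist_eq]
      exact h2 x hx x' hx'
    intro a ha b hb
    exact this (show (a, b) ∈ R ×ˢ R from ⟨ha, hb⟩)
  let f : ℝ → X := fun s => if h : ∃ x, (s, x) ∈ R then h.choose else x₀
  have hf : ∀ a ∈ R, f a.1 = a.2 := by
    intro a ha
    have hex : ∃ x, (a.1, x) ∈ R := ⟨a.2, ha⟩
    have : f a.1 = hex.choose := by simp only [f]; rw [dif_pos hex]
    rw [this]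
    have h3 := hexp _ hex.choose_spec a ha
    simp only [dist_self] at h3
    exact dist_le_zero.1 h3
  refine ⟨f, Prod.fst '' R, hRc.image continuous_fst, ?_, ?_⟩
  · refine LipschitzOnWith.of_dist_le_mul ?_
    rintro _ ⟨a, ha, rfl⟩ _ ⟨b, hb, rfl⟩
    rw [hf a ha, hf b hb]
    simpa using hexp a ha b hb
  · intro x hx
    have hm : (τ x, x) ∈ R := subset_closure ⟨x, hx, rfl⟩
    exact ⟨τ x, ⟨_, hm, rfl⟩, hf _ hm⟩

/-- The lens of two good points has large measure, in dimension one. -/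
lemma hgood_lens (μ : Measure X) [IsFiniteMeasure μ] (ε δ : ℝ) (hε : 0 < ε) (hε1 : ε ≤ 1 / 100)
    (y z : X) (hy : HGood μ 1 ε δ y) (hz : HGood μ 1 ε δ z) (hd : dist y z ≤ δ / 4) :
    dist y z ≤ 10 * μ.real (hLens (y, z)) := by
  by_cases hyz : y = z
  · subst hyz; simp [measureReal_nonneg]
  set r := dist y z with hr
  have hr0 : 0 < r := dist_pos.2 hyz
  have h1 := hy.1 (0.6 * r) (by positivity) (by linarith)
  have h2 := hz.1 (0.6 * r) (by positivity) (by linarith)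
  have h3 := hy.2 (closedBall y (0.6 * r) ∪ closedBall z (0.6 * r)) (2.2 * r)
    (Or.inl (mem_closedBall_self (by positivity))) (by linarith) (by
      rintro a (ha | ha) b (hb | hb) <;> rw [mem_closedBall] at ha hb
      · linarith [dist_triangle_right a b y]
      · linarith [dist_triangle4_right a b y z]
      · linarith [dist_triangle4_right a b z y, dist_comm z y]
      · linarith [dist_triangle_right a b z])
  have h4 := measureReal_union_add_inter (μ := μ) (s := closedBall y (0.6 * r))
    (t := closedBall z (0.6 * r)) measurableSet_closedBall
  simp only [Real.rpow_one] at h1 h2 h3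
  have h5 : μ.real (hLens (y, z)) = μ.real (closedBall y (0.6 * r) ∩ closedBall z (0.6 * r)) := rfl
  rw [h5]
  nlinarith

end MetricPart

section HeisPart

open Metric Set Topology

/-- Horizontal distance. -/
noncomputable def hnd (p q : Heis) : ℝ := Heis.enorm2 (p.h - q.h)

/-- Vertical difference. -/
noncomputable def hvt (p q : Heis) : ℝ := p.v - q.v - 2 * Heis.omega p.h q.h

lemma hnd_nonneg (p q : Heis) : 0 ≤ hnd p q := Real.sqrt_nonneg _

lemma hnd_sq (p q : Heis) : hnd p q ^ 2 = (p.h.1 - q.h.1) ^ 2 + (p.h.2 - q.h.2) ^ 2 := by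
  unfold hnd Heis.enorm2
  rw [Real.sq_sqrt (by positivity)]
  rfl

lemma koranyi_nonneg (p q : Heis) : 0 ≤ Heis.koranyi p q := by
  unfold Heis.koranyi; positivity

lemma koranyi_pow (p q : Heis) : Heis.koranyi p q ^ 4 = hnd p q ^ 4 + hvt p q ^ 2 := by
  unfold Heis.koranyi
  rw [← Real.rpow_natCast, ← Real.rpow_mul (by positivity)]
  norm_num [hnd, hvt]

variable [MetricSpace Heis]

lemma hdist_pow (hd : ∀ p q : Heis, dist p q = Heis.koranyi p q) (p q : Heis) :
    dist p q ^ 4 = hnd p q ^ 4 + hvt p q ^ 2 := by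
  rw [hd, koranyi_pow]

lemma hnd_le (hd : ∀ p q : Heis, dist p q = Heis.koranyi p q) (p q : Heis) :
    hnd p q ≤ dist p q := by
  have h := hdist_pow hd p q
  refine le_of_pow_le_pow_left₀ (n := 4) (by norm_num) dist_nonneg ?_
  nlinarith [sq_nonneg (hvt p q)]

lemma hvt_le (hd : ∀ p q : Heis, dist p q = Heis.koranyi p q) (p q : Heis) :
    |hvt p q| ≤ dist p q ^ 2 := by
  have h := hdist_pow hd p q
  refine abs_le_of_sq_le_sq ?_ (by positivity)
  have : 0 ≤ hnd p q ^ 4 := by positivity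
  nlinarith

lemma hdist_sq (hd : ∀ p q : Heis, dist p q = Heis.koranyi p q) (p q : Heis) :
    dist p q ^ 2 = ‖(⟨hnd p q ^ 2, hvt p q⟩ : ℂ)‖ := by
  have h := hdist_pow hd p q
  rw [Complex.norm_def, Complex.normSq_mk]
  symm
  rw [Real.sqrt_eq_iff_mul_self_eq (by nlinarith [sq_nonneg (hnd p q ^ 2), sq_nonneg (hvt p q)])
    (by positivity)]
  nlinarith

lemma hdist_tri (hd : ∀ p q : Heis, dist p q = Heis.koranyi p q) (x p q : Heis) :
    dist p q ^ 2 ≤ dist p x ^ 2 + dist x q ^ 2 + 2 * (hnd p x * hnd x q) := by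
  rw [hdist_sq hd p q, hdist_sq hd p x, hdist_sq hd x q]
  set a1 := p.h.1 - x.h.1 with ha1
  set a2 := p.h.2 - x.h.2 with ha2
  set b1 := x.h.1 - q.h.1 with hb1
  set b2 := x.h.2 - q.h.2 with hb2
  have e : (⟨hnd p q ^ 2, hvt p q⟩ : ℂ) = ⟨hnd p x ^ 2, hvt p x⟩ + ⟨hnd x q ^ 2, hvt x q⟩ +
      ⟨2 * (a1 * b1 + a2 * b2), 2 * (a1 * b2 - a2 * b1)⟩ := by
    apply Complex.ext
    · simp only [Complex.add_re, hnd_sq]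
      rw [ha1, ha2, hb1, hb2]; ring
    · simp only [Complex.add_im, hvt, Heis.omega]
      rw [ha1, ha2, hb1, hb2]; ring
  have h3 : ‖(⟨2 * (a1 * b1 + a2 * b2), 2 * (a1 * b2 - a2 * b1)⟩ : ℂ)‖
      = 2 * (hnd p x * hnd x q) := by
    rw [Complex.norm_def, Complex.normSq_mk]
    rw [Real.sqrt_eq_iff_mul_self_eq
      (by nlinarith [sq_nonneg (a1 * b1 + a2 * b2), sq_nonneg (a1 * b2 - a2 * b1)])
      (by have := hnd_nonneg p x; have := hnd_nonneg x q; positivity)]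
    have : (2 * (hnd p x * hnd x q)) * (2 * (hnd p x * hnd x q))
        = 4 * (hnd p x ^ 2 * hnd x q ^ 2) := by ring
    rw [this, hnd_sq, hnd_sq]
    ring
  rw [e, ← h3]
  exact (norm_add_le _ _).trans (by gcongr; exact norm_add_le _ _)

lemma hflat_of_antipode (hd : ∀ p q : Heis, dist p q = Heis.koranyi p q) (η : ℝ) (hη : 0 < η)
    (hη1 : η < 1 / 2) (x p : Heis)
    (h : ∃ q, dist x q ≤ dist x p ∧ (2 - 3 * η) * dist x p ≤ dist p q) :
    (1 - 6 * η) * dist x p ≤ hnd p x := by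
  obtain ⟨q, h1, h2⟩ := h
  have h3 := hdist_tri hd x p q
  rw [dist_comm p x] at h3
  set r := dist x p with hr
  have hr0 : 0 ≤ r := dist_nonneg
  have h4 : hnd x q ≤ r := (hnd_le hd x q).trans h1
  have h5 := hnd_nonneg p x
  have h6 : ((2 - 3 * η) * r) ^ 2 ≤ dist p q ^ 2 := by
    have : 0 ≤ (2 - 3 * η) * r := mul_nonneg (by linarith) hr0
    gcongr
  have h7 : dist x q ^ 2 ≤ r ^ 2 := by gcongr
  have h8 : hnd p x * hnd x q ≤ hnd p x * r := by gcongr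
  rcases hr0.eq_or_lt with h0 | h0
  · rw [← h0]; simpa using h5
  have h9 : (1 - 6 * η) * r * r ≤ hnd p x * r := by nlinarith [mul_nonneg (sq_nonneg η) (sq_nonneg r)]
  exact le_of_mul_le_mul_right h9 h0

/-- Flatness of a set of points. -/
def HFlat (κ : ℝ) (G : Set Heis) : Prop :=
  ∀ x ∈ G, ∀ y ∈ G, (1 - κ) * dist x y ≤ hnd x y

lemma hflat_vt (hd : ∀ p q : Heis, dist p q = Heis.koranyi p q) (σ : ℝ) (hσ : 0 < σ) (hσ1 : σ ≤ 1)
    (G : Set Heis) (hG : HFlat (σ ^ 2) G) (x y : Heis) (hx : x ∈ G) (hy : y ∈ G) :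
    |hvt x y| ≤ 2 * σ * dist x y ^ 2 := by
  have h := hdist_pow hd x y
  have h1 := hG x hx y hy
  have hs : σ ^ 2 ≤ 1 := by nlinarith
  have h2 : ((1 - σ ^ 2) * dist x y) ^ 4 ≤ hnd x y ^ 4 := by
    have : 0 ≤ (1 - σ ^ 2) * dist x y := mul_nonneg (by linarith) dist_nonneg
    gcongr
  have h3 : 1 - 4 * σ ^ 2 ≤ (1 - σ ^ 2) ^ 4 := by
    have := one_add_mul_le_pow (a := -σ ^ 2) (by nlinarith) 4
    norm_num at this
    have e : (1 - σ ^ 2) = 1 + -σ ^ 2 := by ring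
    rw [e]
    linarith
  refine abs_le_of_sq_le_sq ?_ (by positivity)
  have h4 : 0 ≤ dist x y ^ 4 := by positivity
  have h5 : (1 - 4 * σ ^ 2) * dist x y ^ 4 ≤ ((1 - σ ^ 2) * dist x y) ^ 4 := by
    rw [mul_pow]; gcongr
  nlinarith

lemma hflat_omega (hd : ∀ p q : Heis, dist p q = Heis.koranyi p q) (σ : ℝ) (hσ : 0 < σ)
    (hσ1 : σ ≤ 1) (G : Set Heis) (hG : HFlat (σ ^ 2) G) (x y z : Heis) (hx : x ∈ G) (hy : y ∈ G)
    (hz : z ∈ G) (D : ℝ) (h1 : dist x y ≤ D) (h2 : dist y z ≤ D) (h3 : dist z x ≤ D) :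
    |(x.h.1 - y.h.1) * (z.h.2 - y.h.2) - (x.h.2 - y.h.2) * (z.h.1 - y.h.1)| ≤ 3 * σ * D ^ 2 := by
  have a1 := hflat_vt hd σ hσ hσ1 G hG x y hx hy
  have a2 := hflat_vt hd σ hσ hσ1 G hG y z hy hz
  have a3 := hflat_vt hd σ hσ hσ1 G hG z x hz hx
  have b1 : 2 * σ * dist x y ^ 2 ≤ 2 * σ * D ^ 2 := by gcongr
  have b2 : 2 * σ * dist y z ^ 2 ≤ 2 * σ * D ^ 2 := by gcongr
  have b3 : 2 * σ * dist z x ^ 2 ≤ 2 * σ * D ^ 2 := by gcongr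
  have e : (x.h.1 - y.h.1) * (z.h.2 - y.h.2) - (x.h.2 - y.h.2) * (z.h.1 - y.h.1)
      = (hvt x y + hvt y z + hvt z x) / 2 := by
    simp only [hvt, Heis.omega]; ring
  rw [e]
  rw [abs_le] at *
  constructor <;> linarith [a1.1, a1.2, a2.1, a2.2, a3.1, a3.2]

lemma hflat_qc (hd : ∀ p q : Heis, dist p q = Heis.koranyi p q)
    (G : Set Heis) (hG : HFlat ((1 / 1000) ^ 2) G) (x y z : Heis) (hx : x ∈ G) (hy : y ∈ G)
    (hz : z ∈ G) (h1 : dist x y ≤ dist x z) (h2 : dist y z ≤ dist x z) :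
    dist x y + dist y z ≤ 1.01 * dist x z := by
  have hw := hflat_omega hd (1 / 1000) (by norm_num) (by norm_num) G hG x y z hx hy hz
    (dist x z) h1 h2 (dist_comm z x).le
  have f1 := hG x hx y hy
  have f2 := hG y hy z hz
  have f3 := hG x hx z hz
  have g1 := hnd_le hd x y
  have g2 := hnd_le hd y z
  have g3 := hnd_le hd x z
  have n1 := hnd_nonneg x y
  have n2 := hnd_nonneg y z
  have n3 := hnd_nonneg x z
  have s1 := hnd_sq x y
  have s2 := hnd_sq y z
  have s3 := hnd_sq x z
  set D := dist x z with hD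
  have hD0 : 0 ≤ D := dist_nonneg
  set U := hnd x y
  set W := hnd y z
  set V := hnd x z
  set u1 := x.h.1 - y.h.1 with hu1
  set u2 := x.h.2 - y.h.2 with hu2
  set w1 := z.h.1 - y.h.1 with hw1
  set w2 := z.h.2 - y.h.2 with hw2
  have s2' : W ^ 2 = w1 ^ 2 + w2 ^ 2 := by rw [s2, hw1, hw2]; ring
  have s3' : V ^ 2 = (u1 - w1) ^ 2 + (u2 - w2) ^ 2 := by rw [s3, hw1, hw2, hu1, hu2]; ring
  set I := u1 * w1 + u2 * w2 with hI
  set O := u1 * w2 - u2 * w1 with hO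
  have hUW : (U * W) ^ 2 = I ^ 2 + O ^ 2 := by rw [mul_pow, s1, s2', hI, hO]; ring
  have hV : V ^ 2 = U ^ 2 + W ^ 2 - 2 * I := by rw [s1, s2', s3', hI]; ring
  have hUWle : U * W ≤ |I| + |O| := by
    refine le_of_sq_le_sq ?_ (by positivity) 
    nlinarith [sq_abs I, sq_abs O, mul_nonneg (abs_nonneg I) (abs_nonneg O)]
  have hVD : V ^ 2 ≤ D ^ 2 := by gcongr
  have hVD' : ((1 - (1 / 1000) ^ 2) * D) ^ 2 ≤ V ^ 2 := by
    have : 0 ≤ (1 - (1 / 1000) ^ 2 : ℝ) * D := mul_nonneg (by norm_num) hD0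
    gcongr
  rcases le_total I 0 with hI0 | hI0
  · rw [abs_of_nonpos hI0] at hUWle
    have e : (U + W) ^ 2 = U ^ 2 + W ^ 2 + 2 * (U * W) := by ring
    have k : (U + W) ^ 2 ≤ (1.003 * D) ^ 2 := by
      rw [e, mul_pow]
      have := sq_nonneg D
      norm_num
      linarith
    have k2 : U + W ≤ 1.003 * D := le_of_sq_le_sq k (by positivity)
    norm_num at f1 f2 ⊢
    linarith
  · rw [abs_of_nonneg hI0] at hUWle
    have e : (U - W) ^ 2 = U ^ 2 + W ^ 2 - 2 * (U * W) := by ring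
    have k : (0.996 * D) ^ 2 ≤ (U - W) ^ 2 := by
      rw [mul_pow] at hVD'
      rw [e, mul_pow]
      have := sq_nonneg D
      norm_num at hVD' ⊢
      linarith
    have k2 : 0.996 * D ≤ |U - W| := by
      have := sq_le_sq.1 k
      rwa [abs_of_nonneg (by positivity)] at this
    norm_num at f1 f2 k2 ⊢
    rcases abs_cases (U - W) with ⟨h, _⟩ | ⟨h, _⟩ <;> rw [h] at k2 <;> linarith

lemma heis_proper (hd : ∀ p q : Heis, dist p q = Heis.koranyi p q) : ProperSpace Heis := by
  let ι : (ℝ × ℝ) × ℝ → Heis := fun p => p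
  have hι : Continuous ι := by
    rw [continuous_iff_continuousAt]
    intro a
    rw [ContinuousAt, tendsto_iff_dist_tendsto_zero]
    have hc : Continuous fun y : (ℝ × ℝ) × ℝ => Heis.koranyi (ι y) (ι a) := by
      have : (fun y : (ℝ × ℝ) × ℝ => Heis.koranyi (ι y) (ι a)) = fun y : (ℝ × ℝ) × ℝ =>
        (Real.sqrt ((y.1.1 - a.1.1) ^ 2 + (y.1.2 - a.1.2) ^ 2) ^ 4 +
          (y.2 - a.2 - 2 * (y.1.1 * a.1.2 - y.1.2 * a.1.1)) ^ 2) ^ ((1 : ℝ) / 4) := rfl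
      rw [this]
      refine Continuous.rpow_const (by fun_prop) fun x => Or.inr (by norm_num)
    have h2 := hc.tendsto a
    rw [← hd, dist_self] at h2
    simpa only [hd] using h2
  refine ⟨fun x r => ?_⟩
  set B := r ^ 2 + 2 * (r * |x.h.1| + r * |x.h.2|) with hB
  have hK : IsCompact ((Icc (x.h.1 - r) (x.h.1 + r) ×ˢ Icc (x.h.2 - r) (x.h.2 + r)) ×ˢ
      Icc (x.v - B) (x.v + B)) := (isCompact_Icc.prod isCompact_Icc).prod isCompact_Icc
  refine (hK.image hι).of_isClosed_subset isClosed_closedBall ?_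
  intro p hp
  rw [mem_closedBall] at hp
  refine ⟨p, ?_, rfl⟩
  have h1 := (hnd_le hd p x).trans hp
  have hr : 0 ≤ r := dist_nonneg.trans hp
  have h2 : |hvt p x| ≤ r ^ 2 := (hvt_le hd p x).trans (by gcongr)
  have h3 := hnd_sq p x
  have h4 : hnd p x ^ 2 ≤ r ^ 2 := by have := hnd_nonneg p x; gcongr
  have h5 : |p.h.1 - x.h.1| ≤ r := abs_le_of_sq_le_sq (by nlinarith [sq_nonneg (p.h.2 - x.h.2)]) hr
  have h6 : |p.h.2 - x.h.2| ≤ r := abs_le_of_sq_le_sq (by nlinarith [sq_nonneg (p.h.1 - x.h.1)]) hr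
  have e : p.v - x.v = hvt p x + 2 * ((p.h.1 - x.h.1) * x.h.2 - (p.h.2 - x.h.2) * x.h.1) := by
    simp only [hvt, Heis.omega]; ring
  have h7 : |(p.h.1 - x.h.1) * x.h.2| ≤ r * |x.h.2| := by rw [abs_mul]; gcongr
  have h8 : |(p.h.2 - x.h.2) * x.h.1| ≤ r * |x.h.1| := by rw [abs_mul]; gcongr
  rw [abs_le] at h2 h5 h6 h7 h8
  refine ⟨⟨⟨?_, ?_⟩, ?_, ?_⟩, ?_, ?_⟩
  · change x.h.1 - r ≤ p.h.1; linarith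
  · change p.h.1 ≤ x.h.1 + r; linarith
  · change x.h.2 - r ≤ p.h.2; linarith
  · change p.h.2 ≤ x.h.2 + r; linarith
  · change x.v - B ≤ p.v; linarith
  · change p.v ≤ x.v + B; linarith

set_option maxHeartbeats 2000000 in
lemma hflat_split (hd : ∀ p q : Heis, dist p q = Heis.koranyi p q) (N : ℕ) (hN : 1 ≤ N)
    (S : Set Heis) (hS : HFlat ((1 / (24 * (N : ℝ))) ^ 2) S) (hb : Bornology.IsBounded S)
    (hD : 0 < diam S) :
    ∃ P : ℕ → Set Heis, (∀ k, P k ⊆ S) ∧ S ⊆ (⋃ k ∈ Finset.range (2 * N + 1), P k) ∧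
      ∀ k, diam (P k) ≤ 4 / N * diam S := by
  have hN0 : (1 : ℝ) ≤ N := by exact_mod_cast hN
  set σ : ℝ := 1 / (24 * (N : ℝ)) with hσ
  have hσ0 : 0 < σ := by positivity
  have hσ1 : σ ≤ 1 / 24 := by
    rw [hσ]; apply one_div_le_one_div_of_le (by norm_num); linarith
  have hσN : σ * N = 1 / 24 := by rw [hσ]; field_simp
  have hκ : σ ^ 2 ≤ 1 / 2 := by nlinarith
  set D := diam S with hDdef
  have hle : ∀ x ∈ S, ∀ y ∈ S, dist x y ≤ D := fun x hx y hy => dist_le_diam_of_mem hb hx hy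
  obtain ⟨p, hp, q, hq, hpq⟩ : ∃ p ∈ S, ∃ q ∈ S, D / 2 < dist p q := by
    by_contra! hcon
    have := diam_le_of_forall_dist_le (by positivity) hcon
    linarith
  have hV0 := hS q hq p hp
  have hVD := (hnd_le hd q p).trans (hle q hq p hp)
  rw [dist_comm] at hpq
  have hV4 : D ≤ 4 * hnd q p := by nlinarith
  have hVs := hnd_sq q p
  set V := hnd q p with hV
  have hVpos : 0 < V := by linarith
  set v1 := q.h.1 - p.h.1 with hv1
  set v2 := q.h.2 - p.h.2 with hv2
  let I : Heis → ℝ := fun y => (y.h.1 - p.h.1) * v1 + (y.h.2 - p.h.2) * v2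
  let O : Heis → ℝ := fun y => (y.h.1 - p.h.1) * v2 - (y.h.2 - p.h.2) * v1
  have hO : ∀ y ∈ S, |O y| ≤ 3 * σ * D ^ 2 := fun y hy =>
    hflat_omega hd σ hσ0 (by linarith) S hS y p q hy hp hq D (hle _ hy _ hp) (hle _ hp _ hq)
      (hle _ hq _ hy)
  have hI : ∀ y ∈ S, |I y| ≤ V * D := by
    intro y hy
    have h1 : (hnd y p * V) ^ 2 = I y ^ 2 + O y ^ 2 := by
      rw [mul_pow, hVs, hnd_sq]; simp only [I, O]; ring
    have h2 : |I y| ≤ hnd y p * V := abs_le_of_sq_le_sq (by nlinarith [sq_nonneg (O y)])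
      (mul_nonneg (hnd_nonneg _ _) hVpos.le)
    have h3 : hnd y p ≤ D := (hnd_le hd y p).trans (hle _ hy _ hp)
    nlinarith
  let g : Heis → ℝ := fun y => (I y / (V * D) + 1) * N
  have hVDpos : 0 < V * D := by positivity
  have hg : ∀ y ∈ S, 0 ≤ g y ∧ g y ≤ 2 * N := by
    intro y hy
    have := abs_le.1 (hI y hy)
    have h1 : -1 ≤ I y / (V * D) := by rw [le_div_iff₀ hVDpos]; linarith
    have h2 : I y / (V * D) ≤ 1 := by rw [div_le_iff₀ hVDpos]; linarith
    constructor
    · exact mul_nonneg (by linarith) (by linarith)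
    · exact mul_le_mul_of_nonneg_right (by linarith) (by linarith)
  refine ⟨fun k => {y ∈ S | ⌊g y⌋₊ = k}, fun k y hy => hy.1, ?_, ?_⟩
  · intro y hy
    rw [mem_iUnion₂]
    refine ⟨⌊g y⌋₊, ?_, hy, rfl⟩
    rw [Finset.mem_range, Nat.lt_succ_iff]
    have := Nat.floor_le_floor (hg y hy).2
    refine this.trans ?_
    have e : (2 * (N : ℝ)) = ((2 * N : ℕ) : ℝ) := by push_cast; ring
    rw [e, Nat.floor_natCast]
  · intro k
    refine diam_le_of_forall_dist_le (by positivity) ?_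
    rintro y ⟨hy, hyk⟩ z ⟨hz, hzk⟩
    have a1 := Nat.floor_le (hg y hy).1
    have a2 := Nat.lt_floor_add_one (g y)
    have b1 := Nat.floor_le (hg z hz).1
    have b2 := Nat.lt_floor_add_one (g z)
    rw [hyk] at a1 a2
    rw [hzk] at b1 b2
    have hgd : g y - g z = (I y - I z) * N / (V * D) := by
      simp only [g]; field_simp; ring
    have hId : |(I y - I z) * N| ≤ V * D := by
      have h1 : |(I y - I z) * N / (V * D)| ≤ 1 := by
        rw [← hgd, abs_le]; constructor <;> linarith
      rwa [abs_div, abs_of_pos hVDpos, div_le_one hVDpos] at h1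
    have hOd : |O y - O z| ≤ 6 * σ * D ^ 2 := by
      have h1 := abs_le.1 (hO y hy)
      have h2 := abs_le.1 (hO z hz)
      rw [abs_le]; constructor <;> linarith
    have hOd2 : |(O y - O z) * N| ≤ V * D := by
      rw [abs_mul, abs_of_nonneg (by linarith : (0 : ℝ) ≤ N)]
      calc |O y - O z| * N ≤ 6 * σ * D ^ 2 * N := by gcongr
        _ = 6 * (σ * N) * D * D := by ring
        _ = D / 4 * D := by rw [hσN]; ring
        _ ≤ V * D := by gcongr; linarith
    have key : (hnd y z * V * N) ^ 2 = ((I y - I z) * N) ^ 2 + ((O y - O z) * N) ^ 2 := by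
      rw [mul_pow, mul_pow, hVs, hnd_sq]; simp only [I, O]; ring
    have k1 : ((I y - I z) * N) ^ 2 ≤ (V * D) ^ 2 := by
      rw [← sq_abs]; gcongr
    have k2 : ((O y - O z) * N) ^ 2 ≤ (V * D) ^ 2 := by
      rw [← sq_abs]; gcongr
    have k3 : hnd y z * V * N ≤ 2 * (V * D) := by
      refine le_of_sq_le_sq ?_ (by positivity)
      rw [key, mul_pow 2 (V * D)]
      have := sq_nonneg (V * D)
      norm_num
      linarith
    have k4 : hnd y z * N ≤ 2 * D := by
      refine le_of_mul_le_mul_right (a := V) ?_ hVpos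
      linarith
    have k5 := hS y hy z hz
    have k6 : dist y z ≤ 2 * hnd y z := by nlinarith [dist_nonneg (x := y) (y := z)]
    have k7 : dist y z * N ≤ 4 * D := by
      calc dist y z * N ≤ 2 * hnd y z * N := by gcongr
        _ ≤ 4 * D := by linarith
    rw [div_mul_eq_mul_div, le_div_iff₀ (by linarith)]
    exact k7

lemma hflat_null [MeasurableSpace Heis] (hd : ∀ p q : Heis, dist p q = Heis.koranyi p q)
    (μ : Measure Heis) [IsFiniteMeasure μ]
    (α : ℝ) (hα : 0 < α) (N : ℕ) (hN : 1 ≤ N)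
    (hNα : (2 * N + 1 : ℝ) * (4 / N) ^ α ≤ 1 / 2)
    (G : Set Heis) (hG : HFlat ((1 / (24 * (N : ℝ))) ^ 2) G) (hb : Bornology.IsBounded G)
    (hup : ∀ S ⊆ G, μ.real S ≤ 2 * diam S ^ α) : μ G = 0 := by
  have main : ∀ k : ℕ, ∀ S ⊆ G, μ.real S ≤ 2 * (1 / 2) ^ k * diam S ^ α := by
    intro k
    induction k with
    | zero => simpa using hup
    | succ k ih =>
      intro S hS
      rcases (diam_nonneg (s := S)).eq_or_lt with h0 | h0
      · have := hup S hS
        rw [← h0, Real.zero_rpow hα.ne'] at this ⊢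
        simpa using this
      obtain ⟨P, hP1, hP2, hP3⟩ := hflat_split hd N hN S
        (fun x hx y hy => hG x (hS hx) y (hS hy)) (hb.subset hS) h0
      have hN0 : (1 : ℝ) ≤ N := by exact_mod_cast hN
      calc μ.real S ≤ μ.real (⋃ k ∈ Finset.range (2 * N + 1), P k) := measureReal_mono hP2 (measure_ne_top _ _)
        _ ≤ ∑ j ∈ Finset.range (2 * N + 1), μ.real (P j) := measureReal_biUnion_finset_le _ _
        _ ≤ ∑ j ∈ Finset.range (2 * N + 1), 2 * (1 / 2) ^ k * (4 / N * diam S) ^ α := by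
            refine Finset.sum_le_sum fun j _ => (ih _ ((hP1 j).trans hS)).trans ?_
            have := hP3 j
            have h2 : 0 ≤ diam (P j) := diam_nonneg
            gcongr
        _ = 2 * (1 / 2) ^ k * diam S ^ α * ((2 * N + 1 : ℝ) * (4 / N) ^ α) := by
            rw [Finset.sum_const, Finset.card_range, nsmul_eq_mul,
              Real.mul_rpow (by positivity) h0.le]
            push_cast; ring
        _ ≤ 2 * (1 / 2) ^ k * diam S ^ α * (1 / 2) := by gcongr
        _ = 2 * (1 / 2) ^ (k + 1) * diam S ^ α := by ring
  have h1 : Tendsto (fun k : ℕ => 2 * (1 / 2 : ℝ) ^ k * diam G ^ α) atTop (𝓝 (2 * 0 * diam G ^ α)) :=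
    ((tendsto_pow_atTop_nhds_zero_of_lt_one (by norm_num) (by norm_num)).const_mul 2).mul_const _
  have h2 : μ.real G ≤ 2 * 0 * diam G ^ α := ge_of_tendsto' h1 fun k => main k G subset_rfl
  have h3 : μ.real G = 0 := le_antisymm (by simpa using h2) measureReal_nonneg
  exact (measureReal_eq_zero_iff).1 h3

lemma exists_N (α : ℝ) (hα : 1 < α) : ∃ N : ℕ, 1 ≤ N ∧ (2 * N + 1 : ℝ) * (4 / N) ^ α ≤ 1 / 2 := by
  have h1 : Tendsto (fun N : ℕ => 3 * 4 ^ α * (N : ℝ) ^ (-(α - 1))) atTop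
      (𝓝 (3 * 4 ^ α * 0)) :=
    ((tendsto_rpow_neg_atTop (by linarith)).comp tendsto_natCast_atTop_atTop).const_mul _
  rw [mul_zero] at h1
  obtain ⟨N, hN1, hN2⟩ := ((h1.eventually (ge_mem_nhds (by norm_num : (0 : ℝ) < 1 / 2))).and
    (eventually_ge_atTop 1)).exists
  refine ⟨N, hN2, le_trans ?_ hN1⟩
  have hN0 : (1 : ℝ) ≤ N := by exact_mod_cast hN2
  have hN0' : (0 : ℝ) < N := by linarith
  rw [Real.div_rpow (by norm_num) (by linarith), neg_sub, Real.rpow_sub hN0', Real.rpow_one]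
  have h4 : (0 : ℝ) < 4 ^ α := by positivity
  have h5 : (0 : ℝ) < (N : ℝ) ^ α := by positivity
  calc (2 * N + 1 : ℝ) * (4 ^ α / N ^ α) ≤ (3 * N) * (4 ^ α / N ^ α) := by gcongr; linarith
    _ = 3 * 4 ^ α * (N / N ^ α) := by ring

lemma exists_eps_antipode (α η : ℝ) (hη : 0 < η) :
    ∃ ε : ℝ, 0 < ε ∧ ε ≤ 1 / 100 ∧
      (1 + ε) * (2 * (1 - η)) ^ α < (1 - ε) * ((2 * (1 - η)) ^ α + η ^ α) := by
  have hB : 0 < η ^ α := by positivity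
  set A := (2 * (1 - η)) ^ α
  set B := η ^ α
  have h : ∀ᶠ ε in 𝓝 (0 : ℝ), (1 + ε) * A < (1 - ε) * (A + B) := by
    refine ContinuousAt.eventually_lt (by fun_prop) (by fun_prop) ?_
    simpa using hB
  have h' : ∀ᶠ ε in 𝓝[>] (0 : ℝ), (1 + ε) * A < (1 - ε) * (A + B) := h.filter_mono nhdsWithin_le_nhds
  have h2 : ∀ᶠ ε in 𝓝[>] (0 : ℝ), ε ∈ Ioc (0 : ℝ) (1 / 100) := Ioc_mem_nhdsGT (by norm_num)
  obtain ⟨ε, a, b⟩ := (h'.and h2).exists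
  exact ⟨ε, b.1, b.2, a⟩

lemma exists_eps_two (α : ℝ) (hα : 0 < α) (hα1 : α < 1) :
    ∃ ε : ℝ, 0 < ε ∧ ε ≤ 1 / 100 ∧ (1 + ε) * 2 ^ α < 2 * (1 - ε) * (1 - ε) ^ α := by
  have h : ∀ᶠ ε in 𝓝 (0 : ℝ), (1 + ε) * 2 ^ α < 2 * (1 - ε) * (1 - ε) ^ α := by
    refine ContinuousAt.eventually_lt (by fun_prop) ?_ ?_
    · refine ContinuousAt.mul (by fun_prop) ?_
      exact ContinuousAt.rpow_const (by fun_prop) (Or.inr hα.le)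
    · have : (2 : ℝ) ^ α < 2 ^ (1 : ℝ) := Real.rpow_lt_rpow_of_exponent_lt (by norm_num) hα1
      simpa using this
  have h' := h.filter_mono (nhdsWithin_le_nhds (s := Ioi 0))
  have h2 : ∀ᶠ ε in 𝓝[>] (0 : ℝ), ε ∈ Ioc (0 : ℝ) (1 / 100) := Ioc_mem_nhdsGT (by norm_num)
  obtain ⟨ε, a, b⟩ := (h'.and h2).exists
  exact ⟨ε, b.1, b.2, a⟩

variable [MeasurableSpace Heis] [BorelSpace Heis]

/-- Good points in a small ball. -/
def HLoc (μ : Measure Heis) (α ε : ℝ) (c : ℕ → Heis) (n k : ℕ) : Set Heis :=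
  {x | HGood μ α ε (1 / ((n : ℝ) + 1)) x} ∩ ball (c k) (1 / ((n : ℝ) + 1) / 8)

lemma hloc_dist (μ : Measure Heis) (α ε : ℝ) (c : ℕ → Heis) (n k : ℕ) (x y : Heis)
    (hx : x ∈ HLoc μ α ε c n k) (hy : y ∈ HLoc μ α ε c n k) :
    dist x y ≤ 1 / ((n : ℝ) + 1) / 4 := by
  have h1 := mem_ball.1 hx.2
  have h2 := mem_ball.1 hy.2
  linarith [dist_triangle_right x y (c k)]

lemma hloc_bounded (μ : Measure Heis) (α ε : ℝ) (c : ℕ → Heis) (n k : ℕ) :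
    Bornology.IsBounded (HLoc μ α ε c n k) := isBounded_ball.subset inter_subset_right

lemma hloc_flat (hd : ∀ p q : Heis, dist p q = Heis.koranyi p q)
    (μ : Measure Heis) [IsFiniteMeasure μ] (α ε η : ℝ) (hε1 : ε < 1) (hη : 0 < η)
    (hη1 : η < 1 / 2)
    (hc : (1 + ε) * (2 * (1 - η)) ^ α < (1 - ε) * ((2 * (1 - η)) ^ α + η ^ α))
    (c : ℕ → Heis) (n k : ℕ) : HFlat (6 * η) (HLoc μ α ε c n k) := by
  intro x hx y hy
  rw [dist_comm]
  refine hflat_of_antipode hd η hη hη1 y x ?_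
  exact hgood_antipode μ α ε _ η hε1 hη hη1 hc y x hy.1 hx.1 (hloc_dist μ α ε c n k _ _ hy hx)

lemma hloc_cover (μ : Measure Heis) (α ε : ℝ) (c : ℕ → Heis) (hc : DenseRange c)
    (n : ℕ) (x : Heis) (hx : HGood μ α ε (1 / ((n : ℝ) + 1)) x) : ∃ k, x ∈ HLoc μ α ε c n k := by
  obtain ⟨k, hk⟩ := hc.exists_dist_lt x (ε := 1 / ((n : ℝ) + 1) / 8) (by positivity)
  exact ⟨k, hx, hk⟩

lemma hloc_null (μ : Measure Heis) (α ε : ℝ) (c : ℕ → Heis) (hc : DenseRange c)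
    (h : ∀ᵐ x ∂μ, ∃ n : ℕ, HGood μ α ε (1 / ((n : ℝ) + 1)) x)
    (h2 : ∀ n k, μ (HLoc μ α ε c n k) = 0) : μ univ = 0 := by
  have h3 : μ (⋃ n, ⋃ k, HLoc μ α ε c n k) = 0 :=
    measure_iUnion_null fun n => measure_iUnion_null fun k => h2 n k
  refine le_antisymm ?_ bot_le
  refine (measure_mono_ae ?_).trans h3.le
  filter_upwards [h] with x hx _
  obtain ⟨n, hn⟩ := hx
  obtain ⟨k, hk⟩ := hloc_cover μ α ε c hc n x hn
  exact mem_iUnion.2 ⟨n, mem_iUnion.2 ⟨k, hk⟩⟩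

theorem heis_main (hd : ∀ p q : Heis, dist p q = Heis.koranyi p q)
    (α : ℝ) (hα : 0 < α) (E : Set Heis) (hE : MeasurableSet E)
    (h0 : 0 < (μH[α] : Measure Heis) E) (hfin : (μH[α] : Measure Heis) E < ⊤)
    (hdens : ∀ᵐ x ∂((μH[α] : Measure Heis).restrict E),
      Tendsto (fun r : ℝ => (μH[α] : Measure Heis) (E ∩ closedBall x r) / ENNReal.ofReal (2 * r) ^ α)
        (𝓝[>] 0) (𝓝 1)) :
    α = 1 ∧ ∃ (f : ℕ → ℝ → Heis) (A : ℕ → Set ℝ) (K : ℕ → ℝ≥0),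
      (∀ i, IsCompact (A i)) ∧ (∀ i, LipschitzOnWith (K i) (f i) (A i)) ∧
      (μH[1] : Measure Heis) (E \ ⋃ i, f i '' A i) = 0 := by
  haveI : ProperSpace Heis := heis_proper hd
  haveI : Nonempty Heis := ⟨((0, 0), 0)⟩
  set c : ℕ → Heis := TopologicalSpace.denseSeq Heis
  have hcd : DenseRange c := TopologicalSpace.denseRange_denseSeq Heis
  have hgood := hgood_ae α hα E hE hfin hdens
  set μ : Measure Heis := (μH[α] : Measure Heis).restrict E with hμ
  haveI : IsFiniteMeasure μ := ⟨by simpa [hμ] using hfin⟩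
  have hμ0 : μ univ ≠ 0 := by simpa [hμ] using h0.ne'
  have hα1 : α = 1 := by
    rcases lt_trichotomy α 1 with h | h | h
    · exfalso
      obtain ⟨ε, e1, e2, e3⟩ := exists_eps_two α hα h
      refine hμ0 (hloc_null μ α ε c hcd (hgood ε e1 (by linarith)) fun n k => ?_)
      have hs : (HLoc μ α ε c n k).Subsingleton := by
        intro x hx y hy
        by_contra hxy
        have := hgood_two μ α ε _ hα e1 (by linarith) x y hx.1 hy.1 hxy
          (hloc_dist μ α ε c n k _ _ hx hy)
        linarith
      have := Measure.nullSingletonClass_hausdorff Heis hα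
      exact le_antisymm ((Measure.restrict_apply_le _ _).trans
        (hs.measure_zero (μH[α] : Measure Heis)).le) bot_le
    · exact h
    · exfalso
      obtain ⟨N, hN, hNα⟩ := exists_N α h
      have hN0 : (1 : ℝ) ≤ N := by exact_mod_cast hN
      set η : ℝ := (1 / (24 * (N : ℝ))) ^ 2 / 6 with hη
      have hη0 : 0 < η := by positivity
      have hη1 : η < 1 / 2 := by
        have : 1 / (24 * (N : ℝ)) ≤ 1 := by
          rw [div_le_one (by positivity)]; linarith
        have : (1 / (24 * (N : ℝ))) ^ 2 ≤ 1 := pow_le_one₀ (by positivity) this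
        linarith
      obtain ⟨ε, e1, e2, e3⟩ := exists_eps_antipode α η hη0
      refine hμ0 (hloc_null μ α ε c hcd (hgood ε e1 (by linarith)) fun n k => ?_)
      have hf := hloc_flat hd μ α ε η (by linarith) hη0 hη1 e3 c n k
      have e : 6 * η = (1 / (24 * (N : ℝ))) ^ 2 := by rw [hη]; ring
      rw [e] at hf
      refine hflat_null hd μ α hα N hN hNα _ hf (hloc_bounded μ α ε c n k) ?_
      intro S hS
      rcases S.eq_empty_or_nonempty with rfl | ⟨x, hx⟩
      · simp [Real.zero_rpow hα.ne']
      have hb := (hloc_bounded μ α ε c n k).subset hS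
      have hδ : (0 : ℝ) < 1 / ((n : ℝ) + 1) := by positivity
      have h1 : diam S ≤ 1 / ((n : ℝ) + 1) := by
        refine diam_le_of_forall_dist_le hδ.le fun y hy z hz => ?_
        have := hloc_dist μ α ε c n k y z (hS hy) (hS hz)
        linarith
      have h2 := (hS hx).1.2 S (diam S) hx h1 fun a ha b hb' => dist_le_diam_of_mem hb ha hb'
      refine h2.trans ?_
      have : 0 ≤ diam S ^ α := Real.rpow_nonneg diam_nonneg _
      nlinarith
  refine ⟨hα1, ?_⟩
  subst hα1
  set η : ℝ := (1 / 1000) ^ 2 / 6 with hη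
  have hη0 : 0 < η := by positivity
  have hη1 : η < 1 / 2 := by rw [hη]; norm_num
  obtain ⟨ε, e1, e2, e3⟩ := exists_eps_antipode 1 η hη0
  have hcov : ∀ n k, ∃ (f : ℝ → Heis) (A : Set ℝ), IsCompact A ∧ LipschitzOnWith 1 f A ∧
      HLoc μ 1 ε c n k ⊆ f '' A := by
    intro n k
    have hf := hloc_flat hd μ 1 ε η (by linarith) hη0 hη1 e3 c n k
    have e : 6 * η = (1 / 1000) ^ 2 := by rw [hη]; ring
    rw [e] at hf
    obtain ⟨τ, t1, t2⟩ := expand_compact (HLoc μ 1 ε c n k) (20 * μ.real univ) (by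
      intro F hF
      refine prim_tour μ F ?_ ?_
      · intro x hx y hy z hz
        exact hflat_qc hd _ hf x y z (hF hx) (hF hy) (hF hz)
      · intro y hy z hz
        exact hgood_lens μ ε _ e1 e2 y z (hF hy).1 (hF hz).1 
          (hloc_dist μ 1 ε c n k _ _ (hF hy) (hF hz)))
    exact expand_image _ (hloc_bounded μ 1 ε c n k) _ τ t1 t2 (c 0)
  choose f A hA hf hsub using hcov
  refine ⟨fun i => f i.unpair.1 i.unpair.2, fun i => A i.unpair.1 i.unpair.2, fun _ => 1,
    fun i => hA _ _, fun i => hf _ _, ?_⟩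
  have hg := hgood ε e1 (by linarith)
  rw [ae_restrict_iff' hE, ae_iff] at hg
  refine measure_mono_null ?_ hg
  rintro x ⟨hxE, hx⟩
  rw [mem_ofPred_eq]
  intro hcon
  obtain ⟨n, hn⟩ := hcon hxE
  obtain ⟨k, hk⟩ := hloc_cover μ 1 ε c hcd n x hn
  refine hx (mem_iUnion.2 ⟨Nat.pair n k, ?_⟩)
  simpa using hsub n k hk

end HeisPart

/-- If `ℝ² × ℝ` is endowed with the Koranyi distance
`d_K(x,y) = (‖x₁-y₁‖⁴ + (x₂-y₂-2ω(x₁,y₁))²)^{1/4}` of the first Heisenberg group,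
and `E` is a Borel set with `0 < ℋᵅ(E) < ∞` whose `α`-density equals `1` at `ℋᵅ`-a.e.
point of `E`, then `α = 1` and `E` is covered, up to an `ℋ¹`-null set, by countably
many Lipschitz images of compact subsets of `ℝ`. -/
theorem statement_4 (m : MetricSpace Heis)
    (hd : ∀ p q : Heis, Heis.dist' m p q = Heis.koranyi p q)
    (α : ℝ) (hα : 0 < α) (E : Set Heis)
    (hE : MeasurableSet[Heis.borelMS m] E)
    (h0 : 0 < Heis.hausdorff m α E) (hfin : Heis.hausdorff m α E < ⊤)
    (hdens : ∀ᵐ x ∂((Heis.hausdorff m α).restrict E),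
      Tendsto
        (fun r : ℝ =>
          Heis.hausdorff m α (E ∩ Heis.cball m x r) / ENNReal.ofReal (2 * r) ^ α)
        (nhdsWithin 0 (Set.Ioi 0)) (nhds 1)) :
    α = 1 ∧
      ∃ (f : ℕ → ℝ → Heis) (A : ℕ → Set ℝ) (K : ℕ → ℝ≥0),
        (∀ i, IsCompact (A i)) ∧
        (∀ i, Heis.lipOn m (K i) (f i) (A i)) ∧
        Heis.hausdorff m 1 (E \ ⋃ i, f i '' A i) = 0 := by
  letI := m
  letI : MeasurableSpace Heis := Heis.borelMS m
  haveI : BorelSpace Heis := ⟨rfl⟩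
  exact heis_main hd α hα E hE h0 hfin hdens
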